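/- One-step reduction for a unary many-valued connective is truth-preserving: for every many-valued valuation v, every unary connective ∼ interpreted by s : X → X, every φ ∈ L and every x ∈ X, 𝔉(v)([x](∼φ)) = 𝔉(v)(⋁_{y ∈ X : x = s(y)} [y]φ); in particular [x](∼φ) is logically equivalent to the finite disjunction ⋁_{y ∈ X : x = s(y)} [y]φ. -/

import Mathlib

/-- Propositional formulas of the many-valued logic `L`, generated from atoms in `H`
by unary connectives indexed by `U` and binary connectives indexed by `B`. -/
inductive Fml (H U B : Type) : Type
  | atom : H → Fml H U B
  | un : U → Fml H U B → Fml H U B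
  | bin : B → Fml H U B → Fml H U B → Fml H U B

/-- The multi-modal 2-valued language `L_M`. -/
inductive MFml (X H U B : Type) : Type
  | bot : MFml X H U B
  | top : MFml X H U B
  | box : X → Fml H U B → MFml X H U B
  | bbox : Bool → MFml X H U B → MFml X H U B
  | and : MFml X H U B → MFml X H U B → MFml X H U B
  | or : MFml X H U B → MFml X H U B → MFml X H U B

variable {X H U B : Type}

/-- Homomorphic extension of a many-valued valuation `v : H → X` to all formulas,
where the unary connective `u` is interpreted by `su u` and the binary connective
`c` by `bo c`. -/
def mvVal (su : U → X → X) (bo : B → X → X → X) (v : H → X) : Fml H U B → X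
  | .atom a => v a
  | .un u φ => su u (mvVal su bo v φ)
  | .bin c φ ψ => bo c (mvVal su bo v φ) (mvVal su bo v ψ)

/-- The modal valuation `𝔉(v) : L_M → 2`. -/
def mval [DecidableEq X] (su : U → X → X) (bo : B → X → X → X) (v : H → X) :
    MFml X H U B → Bool
  | .bot => false
  | .top => true
  | .box x φ => decide (mvVal su bo v φ = x)
  | .bbox b Φ => decide (mval su bo v Φ = b)
  | .and Φ Ψ => mval su bo v Φ && mval su bo v Ψ
  | .or Φ Ψ => mval su bo v Φ || mval su bo v Ψ

/-- Finite disjunction (empty disjunction is `0`). -/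
def bigOr : List (MFml X H U B) → MFml X H U B
  | [] => .bot
  | Φ :: l => .or Φ (bigOr l)

/-- Finite conjunction (empty conjunction is `1`). -/
def bigAnd : List (MFml X H U B) → MFml X H U B
  | [] => .top
  | Φ :: l => .and Φ (bigAnd l)

/-- `⋁_{y ∈ X : x = s(y)} [y]φ`. -/
noncomputable def unDisj [Fintype X] [DecidableEq X] (su : U → X → X) (x : X) (u : U)
    (φ : Fml H U B) : MFml X H U B :=
  bigOr (((Finset.univ.filter fun y => x = su u y)).toList.map fun y => .box y φ)

/-- `⋁_{(y,z) ∈ X×X : x = o(y,z)} ([y]φ ∧ [z]ψ)`. -/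
noncomputable def binDisj [Fintype X] [DecidableEq X] (bo : B → X → X → X) (x : X) (c : B)
    (φ ψ : Fml H U B) : MFml X H U B :=
  bigOr (((Finset.univ.filter fun p : X × X => x = bo c p.1 p.2)).toList.map
    fun p => .and (.box p.1 φ) (.box p.2 ψ))

/-- `⋁_{(b1,b2) ∈ 2×2 : b = op(b1,b2)} ([b1]Φ ∧ [b2]Ψ)`. -/
noncomputable def boolDisj (op : Bool → Bool → Bool) (b : Bool) (Φ Ψ : MFml X H U B) : MFml X H U B :=
  bigOr (((Finset.univ.filter fun p : Bool × Bool => b = op p.1 p.2)).toList.map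
    fun p => .and (.bbox p.1 Φ) (.bbox p.2 Ψ))

/-- The derivability relation `Γ ⊩ (Φ ⊢ Ψ)` of the Gentzen system `G`. -/
inductive Deriv [Fintype X] [DecidableEq X] (su : U → X → X) (bo : B → X → X → X)
    (Γ : Set (MFml X H U B × MFml X H U B)) : MFml X H U B → MFml X H U B → Prop
  | hyp {Φ Ψ} : (Φ, Ψ) ∈ Γ → Deriv su bo Γ Φ Ψ
  | refl (Φ) : Deriv su bo Γ Φ Φ
  | top (Φ) : Deriv su bo Γ Φ .top
  | bot (Φ) : Deriv su bo Γ .bot Φ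
  | andE1 (Φ Ψ) : Deriv su bo Γ (.and Φ Ψ) Φ
  | andE2 (Φ Ψ) : Deriv su bo Γ (.and Φ Ψ) Ψ
  | orI1 (Φ Ψ) : Deriv su bo Γ Φ (.or Φ Ψ)
  | orI2 (Φ Ψ) : Deriv su bo Γ Φ (.or Ψ Φ)
  | distrib (Φ Ψ Υ) :
      Deriv su bo Γ (.and Φ (.or Ψ Υ)) (.or (.and Φ Ψ) (.and Φ Υ))
  | introBoolAnd (b Φ Ψ) :
      Deriv su bo Γ (boolDisj (· && ·) b Φ Ψ) (.bbox b (.and Φ Ψ))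
  | introBoolOr (b Φ Ψ) :
      Deriv su bo Γ (boolDisj (· || ·) b Φ Ψ) (.bbox b (.or Φ Ψ))
  | introUn (x u φ) : Deriv su bo Γ (unDisj su x u φ) (.box x (.un u φ))
  | introBin (x c φ ψ) : Deriv su bo Γ (binDisj bo x c φ ψ) (.box x (.bin c φ ψ))
  | elimBoolAnd (b Φ Ψ) :
      Deriv su bo Γ (.bbox b (.and Φ Ψ)) (boolDisj (· && ·) b Φ Ψ)
  | elimBoolOr (b Φ Ψ) :
      Deriv su bo Γ (.bbox b (.or Φ Ψ)) (boolDisj (· || ·) b Φ Ψ)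
  | elimUn (x u φ) : Deriv su bo Γ (.box x (.un u φ)) (unDisj su x u φ)
  | elimBin (x c φ ψ) : Deriv su bo Γ (.box x (.bin c φ ψ)) (binDisj bo x c φ ψ)
  | cut {Φ Ψ Υ} : Deriv su bo Γ Φ Ψ → Deriv su bo Γ Ψ Υ → Deriv su bo Γ Φ Υ
  | lowerBound {Φ Ψ Υ} :
      Deriv su bo Γ Φ Ψ → Deriv su bo Γ Φ Υ → Deriv su bo Γ Φ (.and Ψ Υ)
  | upperBound {Φ Ψ Υ} :
      Deriv su bo Γ Φ Ψ → Deriv su bo Γ Υ Ψ → Deriv su bo Γ (.or Φ Υ) Ψ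

/-- Formulas of `L_M` with no nested modal operators. -/
inductive NoNest : MFml X H U B → Prop
  | bot : NoNest .bot
  | top : NoNest .top
  | box (x φ) : NoNest (.box x φ)
  | and {Φ Ψ} : NoNest Φ → NoNest Ψ → NoNest (.and Φ Ψ)
  | or {Φ Ψ} : NoNest Φ → NoNest Ψ → NoNest (.or Φ Ψ)

/-- The canonical reduct of `[x]φ` (Definition 3 of the paper). -/
noncomputable def reduct [Fintype X] [DecidableEq X] (su : U → X → X) (bo : B → X → X → X) :
    Fml H U B → X → MFml X H U B
  | .atom A, x => .box x (.atom A)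
  | .un u φ, x =>
      bigOr (((Finset.univ.filter fun y => x = su u y)).toList.map
        fun y => reduct su bo φ y)
  | .bin c φ ψ, x =>
      bigOr (((Finset.univ.filter fun p : X × X => x = bo c p.1 p.2)).toList.map
        fun p => .and (reduct su bo φ p.1) (reduct su bo ψ p.2))

/-- Homomorphic extension of a substitution `σ : H → L` to `L`. -/
def subFml (σ : H → Fml H U B) : Fml H U B → Fml H U B
  | .atom A => σ A
  | .un u φ => .un u (subFml σ φ)
  | .bin c φ ψ => .bin c (subFml σ φ) (subFml σ ψ)

/-- Extension `σ_M : L_M → L_M` of a substitution. -/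
def subM (σ : H → Fml H U B) : MFml X H U B → MFml X H U B
  | .bot => .bot
  | .top => .top
  | .box x φ => .box x (subFml σ φ)
  | .bbox b Φ => .bbox b (subM σ Φ)
  | .and Φ Ψ => .and (subM σ Φ) (subM σ Ψ)
  | .or Φ Ψ => .or (subM σ Φ) (subM σ Ψ)

/-- Satisfaction at a possible world of the autoreferential Kripke model
(worlds `W = X ⊕ 2`, accessibility `R_u = W × {u}`). -/
def sat (su : U → X → X) (bo : B → X → X → X) (v : H → X) :
    (X ⊕ Bool) → MFml X H U B → Prop
  | _, .bot => False
  | _, .top => True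
  | _, .box x φ => mvVal su bo v φ = x
  | _, .bbox b Φ => sat su bo v (Sum.inr b) Φ
  | w, .and Φ Ψ => sat su bo v w Φ ∧ sat su bo v w Ψ
  | w, .or Φ Ψ => sat su bo v w Φ ∨ sat su bo v w Ψ

/-- The sequent bivaluation `𝔅(v)`. -/
def biv [DecidableEq X] (su : U → X → X) (bo : B → X → X → X) (v : H → X)
    (s : MFml X H U B × MFml X H U B) : Bool :=
  decide (mval su bo v s.1 = (mval su bo v s.1 && mval su bo v s.2))

/-- Modal literal `[y₁]…[y_{k-1}][x]A`. -/
def modalLit (l : List Bool) (x : X) (A : H) : MFml X H U B :=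
  l.foldr (fun b Φ => MFml.bbox b Φ) (MFml.box x (Fml.atom A))

/-- The theory `T_v` determined by a many-valued valuation `v`. -/
def Tv (v : H → X) : Set (MFml X H U B × MFml X H U B) :=
  {s | ∃ (A : H) (x : X), v A = x ∧
      (s = (MFml.top, MFml.box x (Fml.atom A)) ∨
       s = (MFml.box x (Fml.atom A), MFml.top))} ∪
  {s | ∃ (A : H) (x : X), v A ≠ x ∧
      (s = (MFml.box x (Fml.atom A), MFml.bot) ∨
       s = (MFml.bot, MFml.box x (Fml.atom A)))}

/-- The derivability relation of the Gentzen system `G` extended with the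
substitution rule. -/
inductive DerivS [Fintype X] [DecidableEq X] (su : U → X → X) (bo : B → X → X → X)
    (Γ : Set (MFml X H U B × MFml X H U B)) : MFml X H U B → MFml X H U B → Prop
  | hyp {Φ Ψ} : (Φ, Ψ) ∈ Γ → DerivS su bo Γ Φ Ψ
  | refl (Φ) : DerivS su bo Γ Φ Φ
  | top (Φ) : DerivS su bo Γ Φ .top
  | bot (Φ) : DerivS su bo Γ .bot Φ
  | andE1 (Φ Ψ) : DerivS su bo Γ (.and Φ Ψ) Φ
  | andE2 (Φ Ψ) : DerivS su bo Γ (.and Φ Ψ) Ψ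
  | orI1 (Φ Ψ) : DerivS su bo Γ Φ (.or Φ Ψ)
  | orI2 (Φ Ψ) : DerivS su bo Γ Φ (.or Ψ Φ)
  | distrib (Φ Ψ Υ) :
      DerivS su bo Γ (.and Φ (.or Ψ Υ)) (.or (.and Φ Ψ) (.and Φ Υ))
  | introBoolAnd (b Φ Ψ) :
      DerivS su bo Γ (boolDisj (· && ·) b Φ Ψ) (.bbox b (.and Φ Ψ))
  | introBoolOr (b Φ Ψ) :
      DerivS su bo Γ (boolDisj (· || ·) b Φ Ψ) (.bbox b (.or Φ Ψ))
  | introUn (x u φ) : DerivS su bo Γ (unDisj su x u φ) (.box x (.un u φ))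
  | introBin (x c φ ψ) : DerivS su bo Γ (binDisj bo x c φ ψ) (.box x (.bin c φ ψ))
  | elimBoolAnd (b Φ Ψ) :
      DerivS su bo Γ (.bbox b (.and Φ Ψ)) (boolDisj (· && ·) b Φ Ψ)
  | elimBoolOr (b Φ Ψ) :
      DerivS su bo Γ (.bbox b (.or Φ Ψ)) (boolDisj (· || ·) b Φ Ψ)
  | elimUn (x u φ) : DerivS su bo Γ (.box x (.un u φ)) (unDisj su x u φ)
  | elimBin (x c φ ψ) : DerivS su bo Γ (.box x (.bin c φ ψ)) (binDisj bo x c φ ψ)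
  | cut {Φ Ψ Υ} : DerivS su bo Γ Φ Ψ → DerivS su bo Γ Ψ Υ → DerivS su bo Γ Φ Υ
  | lowerBound {Φ Ψ Υ} :
      DerivS su bo Γ Φ Ψ → DerivS su bo Γ Φ Υ → DerivS su bo Γ Φ (.and Ψ Υ)
  | upperBound {Φ Ψ Υ} :
      DerivS su bo Γ Φ Ψ → DerivS su bo Γ Υ Ψ → DerivS su bo Γ (.or Φ Υ) Ψ
  | subst {Φ Ψ} (σ : H → Fml H U B) :
      DerivS su bo Γ Φ Ψ → DerivS su bo Γ (subM σ Φ) (subM σ Ψ)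

/-- A finite disjunction is true iff one of its disjuncts is. -/
theorem mval_bigOr_eq_true_iff [DecidableEq X] (su : U → X → X) (bo : B → X → X → X)
    (v : H → X) (l : List (MFml X H U B)) :
    mval su bo v (bigOr l) = true ↔ ∃ Φ ∈ l, mval su bo v Φ = true := by
  induction l with
  | nil => simp [bigOr, mval]
  | cons Φ l ih => simp [bigOr, mval, ih]

/-- One-step reduction for a unary many-valued connective is
truth-preserving. -/
theorem one_step_unary [Fintype X] [DecidableEq X]
    (su : U → X → X) (bo : B → X → X → X) :
    ∀ (v : H → X) (u : U) (φ : Fml H U B) (x : X),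
      mval su bo v (.box x (.un u φ)) = mval su bo v (unDisj su x u φ) := by
  intro v u φ x
  rw [Bool.eq_iff_iff, unDisj, mval_bigOr_eq_true_iff]
  suffices h : mvVal su bo v (.un u φ) = x ↔ x = su u (mvVal su bo v φ) by simpa [mval] using h
  exact eq_comm
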